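/- arXiv:1811.07360 — 2 statements merged into one kernel-verified Lean document; each statement's English description precedes it below -/
import Mathlib

section
/- The function η : (0,∞) → ℝ defined by η(t) = t^{−κ}·[(2−q)·t²·φ(t) + t³·φ′(t)] is strictly decreasing on (0,∞), and lim_{t→0⁺} η(t) = +∞ while lim_{t→∞} η(t) = 0. -/
open Set Filter Topology

lemma aux_lower (l : ℝ) (g g1 g2 : ℝ → ℝ)
    (h1 : ∀ t > 0, HasDerivAt g (g1 t) t) (h2 : ∀ t > 0, HasDerivAt g1 (g2 t) t)
    (h0 : Tendsto g (𝓝[>] 0) (𝓝 0)) (hp : ∀ t > 0, 0 < g1 t)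
    (hb : ∀ t > 0, (l - 2) * g1 t ≤ t * g2 t) :
    ∀ t > 0, (l - 1) * g t ≤ t * g1 t := by
  have hd : ∀ t > 0, HasDerivAt (fun t => t * g1 t - (l - 1) * g t)
      (1 * g1 t + t * g2 t - (l - 1) * g1 t) t := fun t ht =>
    ((hasDerivAt_id t).mul (h2 t ht)).sub ((h1 t ht).const_mul (l - 1))
  have hm : MonotoneOn (fun t => t * g1 t - (l - 1) * g t) (Ioi 0) := by
    apply monotoneOn_of_deriv_nonneg (convex_Ioi 0)
    · exact fun t ht => (hd t ht).continuousAt.continuousWithinAt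
    · intro t ht
      rw [interior_Ioi] at ht
      exact (hd t ht).differentiableAt.differentiableWithinAt
    · intro t ht
      rw [interior_Ioi] at ht
      rw [(hd t ht).deriv]
      have := hb t ht
      linarith
  intro t ht
  have hlim : Tendsto (fun s => -(l - 1) * g s) (𝓝[>] 0) (𝓝 (-(l - 1) * 0)) := h0.const_mul _
  have : -(l - 1) * 0 ≤ t * g1 t - (l - 1) * g t := by
    apply le_of_tendsto hlim
    filter_upwards [Ioo_mem_nhdsGT ht] with s hs
    have := hm (mem_Ioi.2 hs.1) (mem_Ioi.2 ht) hs.2.le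
    have := mul_pos hs.1 (hp s hs.1)
    simp only at *
    linarith
  linarith

lemma aux_upper (m : ℝ) (hm1 : 1 < m) (g g1 g2 : ℝ → ℝ)
    (h1 : ∀ t > 0, HasDerivAt g (g1 t) t) (h2 : ∀ t > 0, HasDerivAt g1 (g2 t) t)
    (hg : ∀ t > 0, 0 < g t)
    (hb : ∀ t > 0, t * g2 t ≤ (m - 2) * g1 t) :
    ∀ t > 0, t * g1 t ≤ (m - 1) * g t := by
  have hd : ∀ t > 0, HasDerivAt (fun t => t * g1 t - (m - 1) * g t)
      (1 * g1 t + t * g2 t - (m - 1) * g1 t) t := fun t ht =>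
    ((hasDerivAt_id t).mul (h2 t ht)).sub ((h1 t ht).const_mul (m - 1))
  have hm : AntitoneOn (fun t => t * g1 t - (m - 1) * g t) (Ioi 0) := by
    apply antitoneOn_of_deriv_nonpos (convex_Ioi 0)
    · exact fun t ht => (hd t ht).continuousAt.continuousWithinAt
    · intro t ht
      rw [interior_Ioi] at ht
      exact (hd t ht).differentiableAt.differentiableWithinAt
    · intro t ht
      rw [interior_Ioi] at ht
      rw [(hd t ht).deriv]
      have := hb t ht
      linarith
  intro t0 ht0
  by_contra! hcon
  set c := t0 * g1 t0 - (m - 1) * g t0 with hc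
  have hcpos : 0 < c := by linarith
  have hk : ∀ t > 0, HasDerivAt (fun t => g t - c * Real.log t) (g1 t - c * t⁻¹) t := fun t ht =>
    (h1 t ht).sub ((Real.hasDerivAt_log (ne_of_gt ht)).const_mul c)
  have hmono : MonotoneOn (fun t => g t - c * Real.log t) (Ioc 0 t0) := by
    apply monotoneOn_of_deriv_nonneg (convex_Ioc 0 t0)
    · exact fun t ht => (hk t ht.1).continuousAt.continuousWithinAt
    · intro t ht
      rw [interior_Ioc] at ht
      exact (hk t ht.1).differentiableAt.differentiableWithinAt
    · intro t ht
      rw [interior_Ioc] at ht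
      rw [(hk t ht.1).deriv]
      have h3 := hm (mem_Ioi.2 ht.1) (mem_Ioi.2 ht0) ht.2.le
      simp only at h3
      have h4 : c ≤ t * g1 t := by nlinarith [hg t ht.1]
      have h5 : c * t⁻¹ ≤ g1 t := by
        rw [← div_eq_mul_inv, div_le_iff₀ ht.1]; linarith
      linarith
  have hlog : ∀ᶠ s in 𝓝[>] (0:ℝ), Real.log s < -((g t0 - c * Real.log t0) / c) :=
    Real.tendsto_log_nhdsGT_zero.eventually (eventually_lt_atBot _)
  obtain ⟨s, hs1, hs2⟩ := (hlog.and (Ioo_mem_nhdsGT ht0)).exists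
  have h3 := hmono ⟨hs2.1, hs2.2.le⟩ ⟨ht0, le_rfl⟩ hs2.2.le
  simp only at h3
  have h4 := hg s hs2.1
  have h5 := mul_lt_mul_of_pos_left hs1 hcpos
  have h6 : c * -((g t0 - c * Real.log t0) / c) = -(g t0 - c * Real.log t0) := by
    field_simp
  linarith

lemma aux_anti (m : ℝ) (g g1 : ℝ → ℝ)
    (h1 : ∀ t > 0, HasDerivAt g (g1 t) t)
    (hb : ∀ t > 0, t * g1 t ≤ (m - 1) * g t) :
    AntitoneOn (fun t => t ^ (1 - m) * g t) (Ioi 0) := by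
  have hd : ∀ t > 0, HasDerivAt (fun t : ℝ => t ^ (1 - m) * g t)
      ((1 - m) * t ^ (1 - m - 1) * g t + t ^ (1 - m) * g1 t) t := fun t ht =>
    (Real.hasDerivAt_rpow_const (Or.inl (ne_of_gt ht))).mul (h1 t ht)
  apply antitoneOn_of_deriv_nonpos (convex_Ioi 0)
  · exact fun t ht => (hd t ht).continuousAt.continuousWithinAt
  · intro t ht
    rw [interior_Ioi] at ht
    exact (hd t ht).differentiableAt.differentiableWithinAt
  · intro t ht
    rw [interior_Ioi] at ht
    have ht' : 0 < t := ht
    rw [(hd t ht).deriv]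
    have e : t ^ (1 - m) = t ^ (1 - m - 1) * t := by
      rw [← Real.rpow_add_one ht'.ne']; congr 1; ring
    rw [e]
    have := hb t ht
    have hp := Real.rpow_pos_of_pos ht' (1 - m - 1)
    nlinarith

lemma aux_main (l m q κ : ℝ) (g g1 g2 : ℝ → ℝ) (hl : 1 < l) (hlm : l ≤ m)
    (h1 : ∀ t > 0, HasDerivAt g (g1 t) t) (h2 : ∀ t > 0, HasDerivAt g1 (g2 t) t)
    (hg : ∀ t > 0, 0 < g t)
    (h0 : Tendsto g (𝓝[>] 0) (𝓝 0)) (hp : ∀ t > 0, 0 < g1 t)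
    (hbl : ∀ t > 0, (l - 2) * g1 t ≤ t * g2 t)
    (hbm : ∀ t > 0, t * g2 t ≤ (m - 2) * g1 t)
    (hmκ : m < κ) (hqH : q < ((κ - 1) * l - m * (m - 1)) / (κ - l)) :
    StrictAntiOn (fun t : ℝ => t ^ (-κ) * ((1 - q) * t * g t + t ^ 2 * g1 t)) (Ioi 0) ∧
    Tendsto (fun t : ℝ => t ^ (-κ) * ((1 - q) * t * g t + t ^ 2 * g1 t)) (𝓝[>] 0) atTop ∧
    Tendsto (fun t : ℝ => t ^ (-κ) * ((1 - q) * t * g t + t ^ 2 * g1 t)) atTop (𝓝 0) := by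
  have hlo := aux_lower l g g1 g2 h1 h2 h0 hp hbl
  have hup := aux_upper m (by linarith) g g1 g2 h1 h2 hg hbm
  have han := aux_anti m g g1 h1 hup
  have hκl : 0 < κ - l := by linarith
  rw [lt_div_iff₀ hκl] at hqH
  have hql : q < l := by
    by_contra! hc
    nlinarith
  have key : ∀ t > 0, t ^ (-κ) * ((1 - q) * t * g t + t ^ 2 * g1 t)
      = t ^ (m - κ) * (t ^ (1 - m) * ((1 - q) * g t + t * g1 t)) := by
    intro t ht
    have e : t ^ (m - κ) * t ^ (1 - m) = t ^ (-κ) * t := by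
      rw [← Real.rpow_add ht, ← Real.rpow_add_one ht.ne']; congr 1; ring
    rw [← mul_assoc, e]; ring
  refine ⟨?_, ?_, ?_⟩
  · have hd : ∀ t > 0, HasDerivAt (fun t : ℝ => t ^ (-κ) * ((1 - q) * t * g t + t ^ 2 * g1 t))
        ((-κ) * t ^ (-κ - 1) * ((1 - q) * t * g t + t ^ 2 * g1 t) + t ^ (-κ) *
          (((1 - q) * 1 * g t + (1 - q) * t * g1 t) + ((2:ℕ) * t ^ (2 - 1) * g1 t + t ^ 2 * g2 t))) t :=
      fun t ht => (Real.hasDerivAt_rpow_const (Or.inl (ne_of_gt ht))).mul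
        ((((hasDerivAt_id t).const_mul (1 - q)).mul (h1 t ht)).add
          ((hasDerivAt_pow 2 t).mul (h2 t ht)))
    apply strictAntiOn_of_deriv_neg (convex_Ioi 0)
    · exact fun t ht => (hd t ht).continuousAt.continuousWithinAt
    · intro t ht
      rw [interior_Ioi] at ht
      have ht' : 0 < t := ht
      rw [(hd t ht).deriv]
      have e : t ^ (-κ) = t ^ (-κ - 1) * t := by
        rw [← Real.rpow_add_one ht'.ne']; congr 1; ring
      rw [e]
      have hP := Real.rpow_pos_of_pos ht' (-κ - 1)
      have hneg : (1 - κ) * (1 - q) * g t + (3 - q - κ) * (t * g1 t) + t * (t * g2 t) < 0 := by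
        have a1 := mul_le_mul_of_nonneg_left (hbm t ht) ht'.le
        have a2 := hlo t ht
        have a3 := hup t ht
        have a4 := hg t ht
        have hA : 0 < (κ - 1) * (1 - q) + (κ + q - m - 1) * (l - 1) := by nlinarith
        have hB : 0 < (κ - 1) * (1 - q) + (κ + q - m - 1) * (m - 1) := by
          have : 0 < (κ - m) * (m - q) := mul_pos (by linarith) (by linarith)
          nlinarith
        have hA' := mul_pos hA a4
        have hB' := mul_pos hB a4
        have hC : 0 < (κ - 1) * (1 - q) * g t + (κ + q - m - 1) * (t * g1 t) := by
          rcases le_total 0 (κ + q - m - 1) with h | h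
          · nlinarith [mul_le_mul_of_nonneg_left a2 h]
          · nlinarith [mul_le_mul_of_nonpos_left a3 h]
        nlinarith
      have := mul_neg_of_pos_of_neg (mul_pos hP ht') hneg
      push_cast
      norm_num
      nlinarith
  · have hpos : 0 < (l - q) * ((1:ℝ) ^ (1 - m) * g 1) := by
      have := hg 1 one_pos
      rw [Real.one_rpow]
      exact mul_pos (by linarith) (by linarith)
    have ht : Tendsto (fun t : ℝ => t ^ (m - κ) * ((l - q) * ((1:ℝ) ^ (1 - m) * g 1)))
        (𝓝[>] 0) atTop :=
      (tendsto_rpow_neg_nhdsGT_zero (by linarith)).atTop_mul_const hpos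
    refine tendsto_atTop_mono' _ ?_ ht
    filter_upwards [Ioo_mem_nhdsGT one_pos] with t ht
    rw [key t ht.1]
    apply mul_le_mul_of_nonneg_left _ (Real.rpow_pos_of_pos ht.1 _).le
    have a := han (mem_Ioi.2 ht.1) (mem_Ioi.2 one_pos) ht.2.le
    simp only at a
    have b := Real.rpow_pos_of_pos ht.1 (1 - m)
    calc (l - q) * ((1:ℝ) ^ (1 - m) * g 1) ≤ (l - q) * (t ^ (1 - m) * g t) :=
          mul_le_mul_of_nonneg_left a (by linarith)
      _ = t ^ (1 - m) * ((l - q) * g t) := by ring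
      _ ≤ _ := mul_le_mul_of_nonneg_left (by linarith [hlo t ht.1]) b.le
  · have ht : Tendsto (fun t : ℝ => t ^ (m - κ) * ((m - q) * ((1:ℝ) ^ (1 - m) * g 1)))
        atTop (𝓝 (0 * ((m - q) * ((1:ℝ) ^ (1 - m) * g 1)))) := by
      have := tendsto_rpow_neg_atTop (y := κ - m) (by linarith)
      rw [neg_sub] at this
      exact this.mul_const _
    rw [zero_mul] at ht
    refine tendsto_of_tendsto_of_tendsto_of_le_of_le' tendsto_const_nhds ht ?_ ?_
    · filter_upwards [eventually_ge_atTop 1] with t ht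
      have ht0 : 0 < t := by linarith
      rw [key t ht0]
      have : 0 ≤ (1 - q) * g t + t * g1 t := by
        have := hlo t ht0
        nlinarith [hg t ht0]
      positivity
    · filter_upwards [eventually_ge_atTop 1] with t ht
      have ht0 : 0 < t := by linarith
      rw [key t ht0]
      apply mul_le_mul_of_nonneg_left _ (Real.rpow_pos_of_pos ht0 _).le
      have a := han (mem_Ioi.2 one_pos) (mem_Ioi.2 ht0) ht
      simp only at a
      have b := Real.rpow_pos_of_pos ht0 (1 - m)
      calc t ^ (1 - m) * ((1 - q) * g t + t * g1 t) ≤ t ^ (1 - m) * ((m - q) * g t) :=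
            mul_le_mul_of_nonneg_left (by linarith [hup t ht0]) b.le
        _ = (m - q) * (t ^ (1 - m) * g t) := by ring
        _ ≤ _ := mul_le_mul_of_nonneg_left a (by linarith)


theorem stmt13 (l m q κ : ℝ) (phi : ℝ → ℝ)
    (hl : 1 < l) (hlm : l ≤ m)
    (hphi_pos : ∀ t > 0, 0 < phi t)
    (hphi_C2 : ContDiffOn ℝ 2 phi (Set.Ioi 0))
    (hphi_1a : Filter.Tendsto (fun t => t * phi t) (nhdsWithin 0 (Set.Ioi 0)) (nhds 0))
    (hphi_1b : Filter.Tendsto (fun t => t * phi t) Filter.atTop Filter.atTop)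
    (hphi_2 : StrictMonoOn (fun t => t * phi t) (Set.Ioi 0))
    (hphi_3pos : ∀ t > 0, 0 < deriv (fun s => s * phi s) t)
    (hphi_3l : ∀ t > 0, (l - 2) * deriv (fun s => s * phi s) t ≤ t * deriv (deriv (fun s => s * phi s)) t)
    (hphi_3m : ∀ t > 0, t * deriv (deriv (fun s => s * phi s)) t ≤ (m - 2) * deriv (fun s => s * phi s) t)
    (hmκ : m < κ) (hq : 0 < q) (hqH : q < ((κ - 1) * l - m * (m - 1)) / (κ - l)) :
    StrictAntiOn (fun t : ℝ => t ^ (-κ) * ((2 - q) * t ^ 2 * phi t + t ^ 3 * deriv phi t)) (Set.Ioi 0) ∧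
    Filter.Tendsto (fun t : ℝ => t ^ (-κ) * ((2 - q) * t ^ 2 * phi t + t ^ 3 * deriv phi t))
      (nhdsWithin 0 (Set.Ioi 0)) Filter.atTop ∧
    Filter.Tendsto (fun t : ℝ => t ^ (-κ) * ((2 - q) * t ^ 2 * phi t + t ^ 3 * deriv phi t))
      Filter.atTop (nhds 0) := by

  have hgC : ContDiffOn ℝ 2 (fun s => s * phi s) (Ioi 0) := contDiffOn_id.mul hphi_C2
  have h1 : ∀ t > 0, HasDerivAt (fun s => s * phi s) (deriv (fun s => s * phi s) t) t :=
    fun t ht => ((hgC.differentiableOn (by norm_num)).differentiableAt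
      (Ioi_mem_nhds ht)).hasDerivAt
  have hgC1 : ContDiffOn ℝ 1 (deriv (fun s => s * phi s)) (Ioi 0) :=
    hgC.deriv_of_isOpen isOpen_Ioi (by norm_num)
  have h2 : ∀ t > 0, HasDerivAt (deriv (fun s => s * phi s))
      (deriv (deriv (fun s => s * phi s)) t) t :=
    fun t ht => ((hgC1.differentiableOn (by norm_num)).differentiableAt
      (Ioi_mem_nhds ht)).hasDerivAt
  have hder : ∀ t > 0, deriv (fun s => s * phi s) t = phi t + t * deriv phi t := by
    intro t ht
    have hp : HasDerivAt phi (deriv phi t) t :=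
      ((hphi_C2.differentiableOn (by norm_num)).differentiableAt (Ioi_mem_nhds ht)).hasDerivAt
    have := ((hasDerivAt_id t).mul hp).deriv
    simp only [id, one_mul] at this
    exact this
  have heq : ∀ t > 0, t ^ (-κ) * ((1 - q) * t * (t * phi t) + t ^ 2 * deriv (fun s => s * phi s) t)
      = t ^ (-κ) * ((2 - q) * t ^ 2 * phi t + t ^ 3 * deriv phi t) := by
    intro t ht
    rw [hder t ht]; ring
  obtain ⟨A, B, C⟩ := aux_main l m q κ (fun s => s * phi s) _ _ hl hlm h1 h2
    (fun t ht => mul_pos ht (hphi_pos t ht)) hphi_1a hphi_3pos hphi_3l hphi_3m hmκ hqH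
  refine ⟨A.congr fun t ht => heq t ht, B.congr' ?_, C.congr' ?_⟩
  · filter_upwards [self_mem_nhdsWithin] with t ht using heq t ht
  · filter_upwards [eventually_gt_atTop 0] with t ht using heq t ht
end

section
/- For every real r with 1 ≤ r < ℓ* and every λ > 0, setting Ψ(t) = t^r / r, one has lim_{t→∞} Ψ(λ·t) / Φ_*(t) = 0; that is, Ψ grows essentially more slowly than Φ_*. -/
open MeasureTheory Set Filter Topology intervalIntegral

theorem aux_int_lower (f : ℝ → ℝ) (a c x0 x : ℝ) (ha : 0 < a) (h0 : 0 < x0) (hx : x0 ≤ x)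
    (hf : IntervalIntegrable f volume x0 x) (h : ∀ s, x0 ≤ s → s ≤ x → c * s ^ (a - 1) ≤ f s) :
    c * (x ^ a - x0 ^ a) / a ≤ ∫ s in x0..x, f s := by
  have h1 : ∫ s in x0..x, c * s ^ (a - 1) = c * (x ^ a - x0 ^ a) / a := by
    rw [intervalIntegral.integral_const_mul, integral_rpow (Or.inl (by linarith))]
    rw [sub_add_cancel]; ring
  rw [← h1]
  refine intervalIntegral.integral_mono_on hx ?_ hf (fun s hs => h s hs.1 hs.2)
  exact (intervalIntegral.intervalIntegrable_rpow' (by linarith)).const_mul c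

theorem aux_int_upper (f : ℝ → ℝ) (a c x0 x : ℝ) (ha : 0 < a) (h0 : 0 < x0) (hx : x0 ≤ x)
    (hf : IntervalIntegrable f volume x0 x) (h : ∀ s, x0 ≤ s → s ≤ x → f s ≤ c * s ^ (a - 1)) :
    ∫ s in x0..x, f s ≤ c * (x ^ a - x0 ^ a) / a := by
  have := aux_int_lower (fun s => - f s) a (-c) x0 x ha h0 hx hf.neg
    (fun s h1 h2 => by have := h s h1 h2; linarith)
  rw [intervalIntegral.integral_neg] at this
  have e : -c * (x ^ a - x0 ^ a) / a = -(c * (x ^ a - x0 ^ a) / a) := by ring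
  linarith

theorem aux_inv_integrable (f g : ℝ → ℝ) (h : ∀ t > 0, g (∫ s in (0:ℝ)..t, f s) = t) :
    ∀ t > 0, IntervalIntegrable f volume 0 t := by
  intro t ht
  by_contra hn
  have hn2 : ¬ IntervalIntegrable f volume 0 (t+1) := by
    intro h2
    apply hn
    apply h2.mono_set
    rw [uIcc_of_le ht.le, uIcc_of_le (by linarith)]
    exact Icc_subset_Icc_right (by linarith)
  have h1 := h t ht
  have h2 := h (t+1) (by linarith)
  rw [intervalIntegral.integral_undef hn] at h1
  rw [intervalIntegral.integral_undef hn2] at h2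
  linarith

theorem aux_surj (f : ℝ → ℝ) (hf : ∀ t > 0, IntervalIntegrable f volume 0 t)
    (hT : Tendsto (fun t => ∫ s in (0:ℝ)..t, f s) atTop atTop) (u : ℝ) (hu : 0 ≤ u) :
    ∃ t, 0 ≤ t ∧ ∫ s in (0:ℝ)..t, f s = u := by
  obtain ⟨T, hT1, hT2⟩ := ((hT.eventually_ge_atTop u).and (eventually_gt_atTop 0)).exists
  have hc : ContinuousOn (fun t => ∫ s in (0:ℝ)..t, f s) (Icc 0 T) := by
    have := intervalIntegral.continuousOn_primitive_interval' (hf T hT2) (left_mem_uIcc)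
    rwa [uIcc_of_le hT2.le] at this
  obtain ⟨t, ht, he⟩ := intermediate_value_Icc hT2.le hc (show u ∈ Icc _ _ from ⟨by simpa using hu, hT1⟩)
  exact ⟨t, ht.1, he⟩

theorem aux_split (f : ℝ → ℝ) (hf : ∀ t > 0, IntervalIntegrable f volume 0 t) (x y : ℝ)
    (hx : 0 < x) (hy : 0 < y) :
    IntervalIntegrable f volume x y ∧
    (∫ s in (0:ℝ)..y, f s) = (∫ s in (0:ℝ)..x, f s) + ∫ s in x..y, f s := by
  have := (hf x hx).symm.trans (hf y hy)
  exact ⟨this, (intervalIntegral.integral_add_adjacent_intervals (hf x hx) this).symm⟩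

theorem aux_mono (f : ℝ → ℝ) (hf : ∀ t > 0, IntervalIntegrable f volume 0 t)
    (hp : ∀ t > 0, 0 ≤ f t) (x y : ℝ) (hx : 0 ≤ x) (hxy : x ≤ y) :
    (∫ s in (0:ℝ)..x, f s) ≤ ∫ s in (0:ℝ)..y, f s := by
  rcases hx.eq_or_lt with rfl | hx
  · rw [intervalIntegral.integral_same, intervalIntegral.integral_of_le hxy]
    exact setIntegral_nonneg measurableSet_Ioc (fun s hs => hp s hs.1)
  · obtain ⟨h1, h2⟩ := aux_split f hf x y hx (by linarith)
    have : 0 ≤ ∫ s in x..y, f s :=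
      intervalIntegral.integral_nonneg hxy (fun s hs => hp s (by linarith [hs.1]))
    linarith

/-- monotonicity of the weighted derivative -/
theorem aux_q (q : ℝ → ℝ) (k : ℝ) (hq : DifferentiableOn ℝ q (Ioi 0))
    (h : ∀ t > 0, k * q t ≤ t * deriv q t) (t : ℝ) (ht : 1 ≤ t) : q 1 * t ^ k ≤ q t := by
  have hd : ∀ t > 0, HasDerivAt (fun t => t ^ (-k) * q t)
      ((-k) * t ^ (-k - 1) * q t + t ^ (-k) * deriv q t) t := by
    intro t ht
    exact (Real.hasDerivAt_rpow_const (Or.inl ht.ne')).mul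
      ((hq t ht).differentiableAt (Ioi_mem_nhds ht)).hasDerivAt
  have hm : MonotoneOn (fun t => t ^ (-k) * q t) (Ioi 0) := by
    apply monotoneOn_of_deriv_nonneg (convex_Ioi 0)
    · exact fun t ht => (hd t ht).continuousAt.continuousWithinAt
    · rw [interior_Ioi]
      exact fun t ht => (hd t ht).differentiableAt.differentiableWithinAt
    · rw [interior_Ioi]
      intro t ht
      have ht' : 0 < t := ht
      rw [(hd t ht).deriv]
      have e : t ^ (-k) = t ^ (-k - 1) * t := by
        rw [← Real.rpow_add_one ht'.ne']; ring_nf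
      rw [e]
      have := mul_nonneg (Real.rpow_nonneg ht'.le (-k - 1)) (sub_nonneg.2 (h t ht))
      nlinarith
  have ht0 : 0 < t := by linarith
  have := hm (show (1:ℝ) ∈ Ioi 0 by simp) (show t ∈ Ioi 0 from ht0) ht
  simp only [Real.one_rpow, one_mul] at this
  calc q 1 * t ^ k ≤ t ^ (-k) * q t * t ^ k := by gcongr
    _ = q t := by rw [mul_right_comm, ← Real.rpow_add ht0]; simp

theorem aux_lower_s18 (F : ℝ → ℝ) (f : ℝ → ℝ) (a c : ℝ) (ha : 0 < a) (hc : 0 < c) (hF1 : 0 < F 1)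
    (hf : ∀ t, 1 ≤ t → IntervalIntegrable f volume 1 t ∧ F t = F 1 + ∫ s in (1:ℝ)..t, f s)
    (h : ∀ s, 1 ≤ s → c * s ^ (a - 1) ≤ f s) :
    ∃ d > 0, ∀ t, 1 ≤ t → d * t ^ a ≤ F t := by
  refine ⟨min (F 1) (c / a), lt_min hF1 (by positivity), fun t ht => ?_⟩
  obtain ⟨h1, h2⟩ := hf t ht
  have := aux_int_lower f a c 1 t ha one_pos ht h1 (fun s hs _ => h s hs)
  rw [Real.one_rpow] at this
  have h3 : 1 ≤ t ^ a := Real.one_le_rpow ht ha.le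
  have e : c * (t ^ a - 1) / a = c / a * (t ^ a - 1) := by ring
  have h4 := mul_le_mul_of_nonneg_right (min_le_right (F 1) (c / a)) (sub_nonneg.2 h3)
  have h5 := min_le_left (F 1) (c / a)
  linarith

theorem aux_upper_s18 (F : ℝ → ℝ) (f : ℝ → ℝ) (a c : ℝ) (ha : 0 < a) (hc : 0 < c) (hF1 : 0 < F 1)
    (hf : ∀ t, 1 ≤ t → IntervalIntegrable f volume 1 t ∧ F t = F 1 + ∫ s in (1:ℝ)..t, f s)
    (h : ∀ s, 1 ≤ s → f s ≤ c * s ^ (a - 1)) :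
    ∃ d > 0, ∀ t, 1 ≤ t → F t ≤ d * t ^ a := by
  refine ⟨max (F 1) (c / a), lt_max_of_lt_left hF1, fun t ht => ?_⟩
  obtain ⟨h1, h2⟩ := hf t ht
  have := aux_int_upper f a c 1 t ha one_pos ht h1 (fun s hs _ => h s hs)
  rw [Real.one_rpow] at this
  have h3 : 1 ≤ t ^ a := Real.one_le_rpow ht ha.le
  have e : c * (t ^ a - 1) / a = c / a * (t ^ a - 1) := by ring
  have h4 := mul_le_mul_of_nonneg_right (le_max_right (F 1) (c / a)) (sub_nonneg.2 h3)
  have h5 := le_max_left (F 1) (c / a)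
  linarith


theorem stmt18 (N : ℕ) (hN : 2 ≤ N) (l m : ℝ) (phi : ℝ → ℝ)
    (hl : 1 < l) (hlm : l ≤ m)
    (hphi_pos : ∀ t > 0, 0 < phi t)
    (hphi_C2 : ContDiffOn ℝ 2 phi (Set.Ioi 0))
    (hphi_1a : Filter.Tendsto (fun t => t * phi t) (nhdsWithin 0 (Set.Ioi 0)) (nhds 0))
    (hphi_1b : Filter.Tendsto (fun t => t * phi t) Filter.atTop Filter.atTop)
    (hphi_2 : StrictMonoOn (fun t => t * phi t) (Set.Ioi 0))
    (hphi_3pos : ∀ t > 0, 0 < deriv (fun s => s * phi s) t)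
    (hphi_3l : ∀ t > 0, (l - 2) * deriv (fun s => s * phi s) t ≤ t * deriv (deriv (fun s => s * phi s)) t)
    (hphi_3m : ∀ t > 0, t * deriv (deriv (fun s => s * phi s)) t ≤ (m - 2) * deriv (fun s => s * phi s) t)
    (hmN : m < N)
    (Phinv : ℝ → ℝ)
    (hPhinv1 : ∀ t ≥ 0, Phinv (∫ s in (0:ℝ)..t, s * phi s) = t)
    (hPhinv2 : ∀ u ≥ 0, (∫ s in (0:ℝ)..(Phinv u), s * phi s) = u)
    (Phis : ℝ → ℝ)
    (hPhis1 : ∀ t > 0, Phis (∫ s in (0:ℝ)..t, Phinv s * s ^ (-((N : ℝ) + 1) / N)) = t)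
    (hPhis2 : ∀ u > 0, (∫ s in (0:ℝ)..(Phis u), Phinv s * s ^ (-((N : ℝ) + 1) / N)) = u) :
    ∀ r : ℝ, 1 ≤ r → r < l * N / (N - l) → ∀ lam > 0,
      Filter.Tendsto (fun t : ℝ => ((lam * t) ^ r / r) / Phis t) Filter.atTop (nhds 0) := by
  have hlN : l < N := by linarith
  have hm0 : 0 < m := by linarith
  have hl0 : 0 < l := by linarith
  have hN0 : (0:ℝ) < N := by linarith
  -- p and its derivative
  set p : ℝ → ℝ := fun s => s * phi s with hpdef
  have hppos : ∀ t > 0, 0 < p t := fun t ht => mul_pos ht (hphi_pos t ht)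
  have hpC2 : ContDiffOn ℝ 2 p (Ioi 0) := contDiffOn_id.mul hphi_C2
  have hqC1 : ContDiffOn ℝ 1 (deriv p) (Ioi 0) :=
    hpC2.deriv_of_isOpen isOpen_Ioi (by norm_num)
  have hqd : DifferentiableOn ℝ (deriv p) (Ioi 0) := hqC1.differentiableOn (by norm_num)
  have hq1 := hphi_3pos 1 one_pos
  have hqlow : ∀ t, 1 ≤ t → deriv p 1 * t ^ (l - 2) ≤ deriv p t :=
    aux_q (deriv p) (l - 2) hqd hphi_3l
  have hqup : ∀ t, 1 ≤ t → deriv p t ≤ deriv p 1 * t ^ (m - 2) := by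
    intro t ht
    have := aux_q (fun t => - deriv p t) (m - 2) hqd.neg (fun t ht => by
      have := hphi_3m t ht
      rw [deriv.fun_neg]
      linarith) t ht
    linarith
  have hpF : ∀ t, 1 ≤ t → IntervalIntegrable (deriv p) volume 1 t ∧
      p t = p 1 + ∫ s in (1:ℝ)..t, deriv p s := by
    intro t ht
    have hsub : uIcc 1 t ⊆ Ioi (0:ℝ) := by
      rw [uIcc_of_le ht]; intro s hs; exact lt_of_lt_of_le one_pos hs.1
    have hi : IntervalIntegrable (deriv p) volume 1 t :=
      (hqd.continuousOn.mono hsub).intervalIntegrable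
    refine ⟨hi, ?_⟩
    rw [intervalIntegral.integral_deriv_eq_sub (fun s hs =>
      ((hpC2.differentiableOn (by norm_num)) s (hsub hs)).differentiableAt
        (Ioi_mem_nhds (hsub hs))) hi]
    ring
  obtain ⟨c1, hc1, hplow⟩ := aux_lower_s18 p (deriv p) (l - 1) _ (by linarith) hq1 (hppos 1 one_pos) hpF
    (fun s hs => by have := hqlow s hs; rwa [show l - 1 - 1 = l - 2 by ring])
  obtain ⟨c2, hc2, hpup⟩ := aux_upper_s18 p (deriv p) (m - 1) _ (by linarith) hq1 (hppos 1 one_pos) hpF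
    (fun s hs => by have := hqup s hs; rwa [show m - 1 - 1 = m - 2 by ring])
  -- Phi
  have hpint := aux_inv_integrable p Phinv (fun t ht => hPhinv1 t ht.le)
  have hPmono := aux_mono p hpint (fun t ht => (hppos t ht).le)
  have hP1 : 0 < ∫ s in (0:ℝ)..1, p s :=
    intervalIntegral.intervalIntegral_pos_of_pos_on (hpint 1 one_pos)
      (fun s hs => hppos s hs.1) one_pos
  have hPF : ∀ t : ℝ, 1 ≤ t → IntervalIntegrable p volume 1 t ∧
      (∫ s in (0:ℝ)..t, p s) = (∫ s in (0:ℝ)..1, p s) + ∫ s in (1:ℝ)..t, p s :=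
    fun t ht => aux_split p hpint 1 t one_pos (by linarith)
  obtain ⟨d1, hd1, hPlow⟩ := aux_lower_s18 (fun t => ∫ s in (0:ℝ)..t, p s) p l c1 hl0 hc1 hP1 hPF hplow
  obtain ⟨d2, hd2, hPup⟩ := aux_upper_s18 (fun t => ∫ s in (0:ℝ)..t, p s) p m c2 hm0 hc2 hP1 hPF hpup
  have hPT : Tendsto (fun t => ∫ s in (0:ℝ)..t, p s) atTop atTop := by
    refine tendsto_atTop_mono' atTop ?_ ((tendsto_rpow_atTop hl0).const_mul_atTop hd1)
    filter_upwards [eventually_ge_atTop 1] with t ht using hPlow t ht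
  have hinv0 : ∀ u, 0 ≤ u → 0 ≤ Phinv u := by
    intro u hu
    obtain ⟨t, ht, he⟩ := aux_surj p hpint hPT u hu
    rw [← he, hPhinv1 t ht]; exact ht
  -- bounds on Phinv
  obtain ⟨C, hC, hinvup⟩ : ∃ C > 0, ∀ u, 1 ≤ u → Phinv u ≤ C * u ^ (1 / l) := by
    refine ⟨max 1 ((1 / d1) ^ (1 / l)), lt_max_of_lt_left one_pos, fun u hu => ?_⟩
    have hu0 : 0 ≤ u := by linarith
    have h1u : 1 ≤ u ^ (1 / l) := Real.one_le_rpow hu (by positivity)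
    rcases le_total 1 (Phinv u) with h | h
    · have h2 := hPlow _ h
      rw [hPhinv2 u hu0] at h2
      have h3 : Phinv u ^ l ≤ 1 / d1 * u := by
        rw [one_div, inv_mul_eq_div, le_div_iff₀ hd1]; linarith
      have h4 := Real.rpow_le_rpow (by have := hinv0 u hu0; positivity) h3
        (show 0 ≤ 1 / l by positivity)
      rw [← Real.rpow_mul (hinv0 u hu0), mul_one_div_cancel hl0.ne', Real.rpow_one,
        Real.mul_rpow (by positivity) hu0] at h4
      exact h4.trans (by gcongr; exact le_max_right _ _)
    · calc Phinv u ≤ 1 * 1 := by linarith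
        _ ≤ _ := by gcongr; exact le_max_left _ _
  set u0 : ℝ := max 1 (∫ s in (0:ℝ)..1, p s) with hu0def
  have hu01 : 1 ≤ u0 := le_max_left _ _
  have hinvlow : ∀ u, u0 ≤ u → (1 / d2) ^ (1 / m) * u ^ (1 / m) ≤ Phinv u := by
    intro u hu
    have hu0 : 0 ≤ u := by linarith
    have hb : (∫ s in (0:ℝ)..1, p s) ≤ u := (le_max_right _ _).trans hu
    have h : 1 ≤ Phinv u := by
      by_contra hcon
      push Not at hcon
      have := hPmono _ 1 (hinv0 u hu0) hcon.le
      rw [hPhinv2 u hu0] at this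
      have e : u = ∫ s in (0:ℝ)..1, p s := le_antisymm this hb
      rw [e, hPhinv1 1 zero_le_one] at hcon
      exact lt_irrefl _ hcon
    have h2 := hPup _ h
    rw [hPhinv2 u hu0] at h2
    have h3 : 1 / d2 * u ≤ Phinv u ^ m := by
      rw [one_div, inv_mul_eq_div, div_le_iff₀ hd2]; linarith
    have h4 := Real.rpow_le_rpow (by positivity) h3 (show 0 ≤ 1 / m by positivity)
    rwa [← Real.rpow_mul (hinv0 u hu0), mul_one_div_cancel hm0.ne', Real.rpow_one,
      Real.mul_rpow (by positivity) hu0] at h4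
  -- G
  set g : ℝ → ℝ := fun s => Phinv s * s ^ (-((N : ℝ) + 1) / N) with hg
  have hgint := aux_inv_integrable g Phis hPhis1
  have hgpos : ∀ t > 0, 0 ≤ g t := fun t ht =>
    mul_nonneg (hinv0 t ht.le) (Real.rpow_nonneg ht.le _)
  have hgmono := aux_mono g hgint hgpos
  have hexp : ∀ k s : ℝ, 0 < s →
      s ^ (1 / k) * s ^ (-((N : ℝ) + 1) / N) = s ^ (1 / k - 1 / N - 1) := by
    intro k s hs
    rw [← Real.rpow_add hs]
    congr 1
    field_simp
    ring
  set b : ℝ := 1 / m - 1 / N with hb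
  have hb0 : 0 < b := sub_pos.2 (one_div_lt_one_div_of_lt hm0 hmN)
  set a : ℝ := 1 / l - 1 / N with ha
  have ha0 : 0 < a := sub_pos.2 (one_div_lt_one_div_of_lt hl0 hlN)
  have hGT : Tendsto (fun t => ∫ s in (0:ℝ)..t, g s) atTop atTop := by
    set e := (1 / d2) ^ (1 / m) with he
    have he0 : 0 < e := by positivity
    have hT : Tendsto (fun t : ℝ => e / b * (t ^ b + - u0 ^ b)) atTop atTop :=
      (tendsto_atTop_add_const_right _ _ (tendsto_rpow_atTop hb0)).const_mul_atTop (by positivity)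
    refine tendsto_atTop_mono' atTop ?_ hT
    filter_upwards [eventually_ge_atTop u0] with t ht
    obtain ⟨h1, h2⟩ := aux_split g hgint u0 t (by linarith) (by linarith)
    have h3 := aux_int_lower g b e u0 t hb0 (by linarith) ht h1 (fun s hs _ => by
      have hs0 : 0 < s := by linarith
      rw [← hexp m s hs0, ← mul_assoc]
      exact mul_le_mul_of_nonneg_right (hinvlow s hs) (Real.rpow_nonneg hs0.le _))
    have h4 := hgmono 0 u0 le_rfl (by linarith)
    rw [intervalIntegral.integral_same] at h4
    have h5 : e * (t ^ b - u0 ^ b) / b = e / b * (t ^ b + - u0 ^ b) := by ring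
    linarith
  have hPhispos : ∀ t > 0, 0 < Phis t := by
    intro t ht
    obtain ⟨x, hx, he⟩ := aux_surj g hgint hGT t ht.le
    have hx0 : 0 < x := by
      rcases hx.eq_or_lt with rfl | h
      · rw [intervalIntegral.integral_same] at he; linarith
      · exact h
    rw [← he, hPhis1 x hx0]; exact hx0
  set A : ℝ := ∫ s in (0:ℝ)..1, g s with hA
  have hA0 : 0 ≤ A := by
    have h4 := hgmono 0 1 le_rfl (by linarith)
    rwa [intervalIntegral.integral_same] at h4
  set K : ℝ := C / a with hK
  have hK0 : 0 < K := by positivity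
  have hmain : ∀ t > 0, t ≤ A + K * Phis t ^ a := by
    intro t ht
    have hx := hPhispos t ht
    have he := hPhis2 t ht
    have hxa : 0 ≤ Phis t ^ a := Real.rpow_nonneg hx.le _
    rcases le_total 1 (Phis t) with h | h
    · obtain ⟨h1, h2⟩ := aux_split g hgint 1 (Phis t) one_pos hx
      have h3 := aux_int_upper g a C 1 (Phis t) ha0 one_pos h h1 (fun s hs _ => by
        have hs0 : 0 < s := by linarith
        rw [← hexp l s hs0, ← mul_assoc]
        exact mul_le_mul_of_nonneg_right (hinvup s hs) (Real.rpow_nonneg hs0.le _))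
      rw [Real.one_rpow] at h3
      have h5 : C * (Phis t ^ a - 1) / a = K * Phis t ^ a - K := by rw [hK]; ring
      linarith
    · have := hgmono _ 1 hx.le h
      have := mul_nonneg hK0.le hxa
      linarith
  intro r hr hrl lam hlam
  have hLa : l * N / (N - l) = 1 / a := by
    have : (N:ℝ) - l ≠ 0 := by linarith
    rw [ha]; field_simp
  rw [hLa] at hrl
  set L := 1 / a with hL
  have hL0 : 0 < L := by positivity
  have hlim : Tendsto (fun t : ℝ => (lam ^ r / r * (2 * K) ^ L) * t ^ (-(L - r))) atTop (𝓝 0) := by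
    have := (tendsto_rpow_neg_atTop (sub_pos.2 hrl)).const_mul (lam ^ r / r * (2 * K) ^ L)
    rwa [mul_zero] at this
  refine squeeze_zero' ?_ ?_ hlim
  · filter_upwards [eventually_gt_atTop 0] with t ht
    have := hPhispos t ht
    positivity
  · filter_upwards [eventually_ge_atTop (2 * A + 1)] with t ht
    have ht0 : 0 < t := by linarith
    have hx := hPhispos t ht0
    have h1 := hmain t ht0
    have h2 : t / (2 * K) ≤ Phis t ^ a := by
      rw [div_le_iff₀ (by positivity)]; linarith
    have h3 := Real.rpow_le_rpow (by positivity) h2 hL0.le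
    rw [← Real.rpow_mul hx.le, hL, mul_one_div_cancel ha0.ne', Real.rpow_one, ← hL] at h3
    have h4 : 0 < (t / (2 * K)) ^ L := by positivity
    calc (lam * t) ^ r / r / Phis t ≤ (lam * t) ^ r / r / (t / (2 * K)) ^ L := by gcongr
      _ = _ := by
        rw [Real.mul_rpow hlam.le ht0.le, Real.div_rpow ht0.le (by positivity), neg_sub,
          Real.rpow_sub ht0]
        have : t ^ L ≠ 0 := by positivity
        have : (2 * K) ^ L ≠ 0 := by positivity
        field_simp
end
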